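/- Let the random vector (X, Y) in ℝ^{k+1} have a centered (mean-zero) Gaussian distribution, where X takes values in ℝ^k with invertible covariance matrix K = E[X Xᵀ] and Y is real-valued. Let κ = E[X Y], φ = K⁻¹κ, v = E[Y²] − κᵀK⁻¹κ, and ε = Y − φᵀX. Then ε is independent of X, and ε has the centered Gaussian distribution on ℝ with variance v. -/

import Mathlib

open MeasureTheory Matrix ProbabilityTheory

lemma hasGaussianLaw_pi_of_forall_sum {Ω ι : Type*} [MeasurableSpace Ω] [Fintype ι]
    {μ : Measure Ω} [IsProbabilityMeasure μ] {Z : Ω → ι → ℝ} (hZ : AEMeasurable Z μ)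
    (h : ∀ L : ι → ℝ, HasGaussianLaw (fun ω => ∑ i, L i * Z ω i) μ) :
    HasGaussianLaw Z μ := by
  rw [hasGaussianLaw_iff_charFunDual_map_eq hZ]
  intro L
  classical
  have hL : L ∘ Z = fun ω => ∑ i, L (Pi.single i 1) * Z ω i := by
    ext ω
    simp only [Function.comp_apply]
    conv_lhs => rw [pi_eq_sum_univ' (Z ω)]
    simp [mul_comm]
  rw [charFunDual_eq_charFun_map_one, AEMeasurable.map_map_of_aemeasurable (by fun_prop) hZ, hL,
    (h _).charFun_map_eq]
  simp

lemma integral_eq_zero_of_map_eq_gaussianReal {Ω : Type*} [MeasurableSpace Ω]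
    {μ : Measure Ω} {X : Ω → ℝ} {s : NNReal} (hX : AEMeasurable X μ)
    (h : μ.map X = gaussianReal 0 s) : μ[X] = 0 := by
  have := integral_map hX (f := id) (by fun_prop)
  rw [h] at this
  simpa using this.symm

/-- The residual of the best linear prediction is uncorrelated with the predictors. -/
lemma integral_sub_dotProduct_mul {Ω ι : Type*} [MeasurableSpace Ω] [Fintype ι]
    {μ : Measure Ω} {X : Ω → ι → ℝ} {Y W : Ω → ℝ} (φ : ι → ℝ)
    (hX : ∀ i, MemLp (fun ω => X ω i) 2 μ) (hY : MemLp Y 2 μ) (hW : MemLp W 2 μ) :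
    ∫ ω, (Y ω - φ ⬝ᵥ X ω) * W ω ∂μ =
      ∫ ω, Y ω * W ω ∂μ - φ ⬝ᵥ fun i => ∫ ω, X ω i * W ω ∂μ := by
  have hXW (i : ι) : Integrable (fun ω => φ i * (X ω i * W ω)) μ :=
    ((hX i).integrable_mul hW).const_mul _
  simp only [dotProduct, sub_mul, Finset.sum_mul, mul_assoc]
  have hYW : Integrable (fun ω => Y ω * W ω) μ := hY.integrable_mul hW
  rw [integral_sub hYW (integrable_finsetSum _ fun i _ => hXW i),
    integral_finsetSum _ fun i _ => hXW i]
  simp only [integral_const_mul]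



/-- If `(X, Y)` in `ℝ^{k+1}` is a centered Gaussian vector (every linear
combination of its coordinates is centered Gaussian), `X` its first `k` coordinates with
invertible covariance matrix `K = E[X Xᵀ]`, `Y` its last coordinate, `κ = E[XY]`,
`φ = K⁻¹κ`, `v = E[Y²] − κᵀK⁻¹κ` and `ε = Y − φᵀX`, then `ε` is independent of `X` and
`ε` has the centered Gaussian distribution with variance `v`. -/
theorem stmt_1 {Ω : Type*} [MeasurableSpace Ω] (μ : Measure Ω) [IsProbabilityMeasure μ]
    {k : ℕ} (Z : Ω → Fin (k + 1) → ℝ) (hZmeas : Measurable Z)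
    (hZgauss : ∀ L : Fin (k + 1) → ℝ, ∃ s : NNReal,
      Measure.map (fun ω => ∑ i, L i * Z ω i) μ = gaussianReal 0 s)
    (X : Ω → Fin k → ℝ) (hXdef : X = fun ω (i : Fin k) => Z ω i.castSucc)
    (Y : Ω → ℝ) (hYdef : Y = fun ω => Z ω (Fin.last k))
    (K : Matrix (Fin k) (Fin k) ℝ)
    (hK : K = Matrix.of fun i j => ∫ ω, X ω i * X ω j ∂μ)
    (hKinv : IsUnit K)
    (κ : Fin k → ℝ) (hκ : κ = fun i => ∫ ω, X ω i * Y ω ∂μ)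
    (φ : Fin k → ℝ) (hφ : φ = K⁻¹ *ᵥ κ)
    (v : ℝ) (hv : v = (∫ ω, (Y ω) ^ 2 ∂μ) - κ ⬝ᵥ (K⁻¹ *ᵥ κ))
    (ε : Ω → ℝ) (hε : ε = fun ω => Y ω - φ ⬝ᵥ X ω) :
    IndepFun ε X μ ∧ Measure.map ε μ = gaussianReal 0 (Real.toNNReal v) := by
  have hZL (L : Fin (k + 1) → ℝ) :
      HasGaussianLaw (fun ω => ∑ i, L i * Z ω i) μ ∧ ∫ ω, ∑ i, L i * Z ω i ∂μ = 0 := by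
    obtain ⟨s, hs⟩ := hZgauss L
    exact ⟨⟨hs ▸ inferInstance⟩,
      integral_eq_zero_of_map_eq_gaussianReal (by fun_prop) hs⟩
  have hZ : HasGaussianLaw Z μ :=
    hasGaussianLaw_pi_of_forall_sum hZmeas.aemeasurable fun L => (hZL L).1
  have hZ0 (i : Fin (k + 1)) : ∫ ω, Z ω i ∂μ = 0 := by
    simpa [Pi.single_apply] using (hZL (Pi.single i 1)).2
  have hZ2 (i : Fin (k + 1)) : MemLp (fun ω => Z ω i) 2 μ := (hZ.eval i).memLp_two
  have hX2 (i : Fin k) : MemLp (fun ω => X ω i) 2 μ := hXdef ▸ hZ2 i.castSucc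
  have hY2 : MemLp Y 2 μ := hYdef ▸ hZ2 (Fin.last k)
  have hX0 (i : Fin k) : ∫ ω, X ω i ∂μ = 0 := by rw [hXdef]; exact hZ0 i.castSucc
  have hY0 : ∫ ω, Y ω ∂μ = 0 := by rw [hYdef]; exact hZ0 (Fin.last k)
  have hjoint : HasGaussianLaw (fun ω => ((fun _ : Unit => ε ω), fun i => X ω i)) μ := by
    let T : (Fin (k + 1) → ℝ) →L[ℝ] ℝ :=
      .proj (Fin.last k) - ∑ i : Fin k, φ i • .proj i.castSucc
    refine (hZ.map_fun ((ContinuousLinearMap.pi fun _ : Unit => T).prod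
      (.pi fun i : Fin k => .proj i.castSucc))).congr (.of_forall fun ω => ?_)
    ext <;> simp [T, hε, hXdef, hYdef, dotProduct]
  have hεlaw : HasGaussianLaw ε μ := hjoint.fst.eval ()
  have hε2 : MemLp ε 2 μ := hεlaw.memLp_two
  have hε0 : ∫ ω, ε ω ∂μ = 0 := by
    have := integral_sub_dotProduct_mul φ hX2 hY2 (memLp_const (μ := μ) (1 : ℝ))
    simpa [hε, hX0, hY0, dotProduct] using this
  have hKφ : K *ᵥ φ = κ := by
    rw [hφ, mulVec_mulVec, mul_nonsing_inv _ ((isUnit_iff_isUnit_det K).1 hKinv), one_mulVec]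
  have hεX (i : Fin k) : ∫ ω, ε ω * X ω i ∂μ = 0 := by
    rw [hε, integral_sub_dotProduct_mul φ hX2 hY2 (hX2 i), sub_eq_zero]
    have := congrFun hKφ i
    simp only [hK, hκ, mulVec, dotProduct_comm _ φ, of_apply] at this
    simpa only [mul_comm] using this.symm
  have hεY : ∫ ω, ε ω * Y ω ∂μ = v := by
    rw [hε, integral_sub_dotProduct_mul φ hX2 hY2 hY2, hv, ← hφ, dotProduct_comm κ, hκ]
    simp only [sq]
  have hεε : ∫ ω, ε ω ^ 2 ∂μ = v := by
    have := integral_sub_dotProduct_mul φ hX2 hY2 hε2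
    simp only [mul_comm _ (ε _), hεX, hεY] at this
    simpa [hε, sq, dotProduct] using this
  constructor
  · refine (hjoint.indepFun_of_covariance_eval (X := fun _ => ε) (Y := fun i ω => X ω i)
      fun _ i => ?_).comp (measurable_pi_apply ()) measurable_id
    rw [covariance_eq_sub hε2 (hX2 i), hε0, zero_mul, sub_zero]
    exact hεX i
  · rw [hεlaw.map_eq_gaussianReal, hε0, variance_of_integral_eq_zero hε2.aemeasurable hε0, hεε]
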